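/- Let φ: R → S be a ring homomorphism of finite flat dimension between normal domains and let M be a reflexive R-module such that M ⊗_R Frac(R) is one-dimensional over Frac(R). Then (M ⊗_R S) ⊗_S Frac(S) is a one-dimensional vector space over Frac(S); that is, M ⊗_R S has rank 1 as an S-module. -/

import Mathlib

open CategoryTheory

/-- The `i`-th Ext module of two `R`-modules, over a commutative ring `R`. -/
noncomputable def ExtModule (R : Type) [CommRing R] (M N : ModuleCat.{0} R) (i : ℕ) :
    ModuleCat R :=
  ((Ext R (ModuleCat.{0} R) i).obj (Opposite.op M)).obj N

/-- `C` is a semidualizing `R`-module: it is finitely generated, the homothety map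
`R → Hom_R(C,C)` is bijective, and `Ext^i_R(C,C) = 0` for all `i > 0`. -/
def IsSemidualizing (R : Type) [CommRing R] (C : Type) [AddCommGroup C] [Module R C] : Prop :=
  Module.Finite R C ∧
  Function.Bijective (algebraMap R (Module.End R C)) ∧
  ∀ i : ℕ, 0 < i → Subsingleton (ExtModule R (ModuleCat.of R C) (ModuleCat.of R C) i)

/-- `M` has finite injective dimension over `R`: `Ext^i_R(-, M)` vanishes uniformly
for all large `i`. -/
def HasFiniteInjectiveDimension (R : Type) [CommRing R] (M : Type) [AddCommGroup M]
    [Module R M] : Prop :=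
  ∃ n : ℕ, ∀ (N : ModuleCat.{0} R) (i : ℕ), n < i →
    Subsingleton (ExtModule R N (ModuleCat.of R M) i)

/-- A Gorenstein local ring: a commutative Noetherian local ring having finite injective
dimension as a module over itself. -/
def IsGorensteinLocalRing (R : Type) [CommRing R] : Prop :=
  IsNoetherianRing R ∧ IsLocalRing R ∧ HasFiniteInjectiveDimension R R

/-- The length of an `R`-module, i.e. the Krull dimension of its lattice of submodules. -/
noncomputable def moduleLength (R M : Type) [CommRing R] [AddCommGroup M] [Module R M] :
    WithBot ℕ∞ :=
  Order.krullDim (Submodule R M)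

/-- `M` has finite flat dimension over `R`: `Tor_i^R(M, -)` vanishes uniformly for all
large `i`. -/
def HasFiniteFlatDimension (R : Type) [CommRing R] (M : Type) [AddCommGroup M]
    [Module R M] : Prop :=
  ∃ n : ℕ, ∀ (N : ModuleCat.{0} R) (i : ℕ), n < i →
    Subsingleton (((Tor (ModuleCat.{0} R) i).obj (ModuleCat.of R M)).obj N)

section Tor

open Limits

namespace CategoryTheory.ProjectiveResolution

variable {C D : Type*} [Category C] [Category D] [Abelian C] [Abelian D]

/-- The augmentation of a projective resolution, with target the resolved object itself. -/
noncomputable def augmentation {X : C} (Q : ProjectiveResolution X) : Q.complex.X 0 ⟶ X :=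
  Q.π.f 0

lemma d_comp_augmentation {X : C} (Q : ProjectiveResolution X) :
    Q.complex.d 1 0 ≫ Q.augmentation = 0 :=
  Q.complex_d_comp_π_f_zero

instance {X : C} (Q : ProjectiveResolution X) : Epi Q.augmentation :=
  inferInstanceAs (Epi (Q.π.f 0))

lemma exact_augmentation {X : C} (Q : ProjectiveResolution X) :
    (ShortComplex.mk _ _ Q.d_comp_augmentation).Exact :=
  Q.exact₀

/-- Splicing a projective resolution of the kernel onto a projective cover. -/
noncomputable def splice {E : ShortComplex C} (hE : E.ShortExact) [Projective E.X₂]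
    (Q : ProjectiveResolution E.X₁) : ProjectiveResolution E.X₃ where
  complex := ChainComplex.augment Q.complex (Q.augmentation ≫ E.f) (by
    rw [← Category.assoc, Q.d_comp_augmentation, zero_comp])
  projective n := by
    cases n
    · exact inferInstanceAs (Projective E.X₂)
    · exact Q.projective _
  π := (ChainComplex.toSingle₀Equiv _ _).symm ⟨E.g, by
    erw [ChainComplex.augment_d_one_zero]
    exact (Category.assoc _ _ _).trans ((congrArg _ E.zero).trans comp_zero)⟩
  quasiIso := ⟨fun n => by
    have := hE.mono_f
    have := hE.epi_g
    cases n with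
    | zero =>
      rw [ChainComplex.quasiIsoAt₀_iff, ShortComplex.quasiIso_iff_of_zeros']
      · have h : (ShortComplex.mk (Q.augmentation ≫ E.f) E.g (by simp)).Exact := by
          let α : ShortComplex.mk (Q.augmentation ≫ E.f) E.g (by simp) ⟶ E :=
            { τ₁ := Q.augmentation
              τ₂ := 𝟙 _
              τ₃ := 𝟙 _ }
          have : Epi α.τ₁ := inferInstanceAs (Epi Q.augmentation)
          have : IsIso α.τ₂ := inferInstanceAs (IsIso (𝟙 _))
          have : Mono α.τ₃ := inferInstanceAs (Mono (𝟙 _))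
          rw [ShortComplex.exact_iff_of_epi_of_isIso_of_mono α]
          exact hE.exact
        refine (ShortComplex.exact_and_epi_g_iff_of_iso ?_).2 ⟨h, hE.epi_g⟩
        exact ShortComplex.isoMk (Iso.refl _) (Iso.refl _) (Iso.refl _)
          ((Category.id_comp _).trans (Category.comp_id _).symm)
          ((Category.id_comp _).trans (Eq.symm ((Category.comp_id _).trans
            (ChainComplex.toSingle₀Equiv_symm_apply_f_zero _ _))))
      all_goals rfl
    | succ n =>
      rw [quasiIsoAt_iff_exactAt']
      · rw [HomologicalComplex.exactAt_iff' _ (n + 1 + 1) (n + 1) n (by simp) (by simp)]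
        cases n with
        | zero =>
          let α : ShortComplex.mk _ _ Q.d_comp_augmentation ⟶
              ShortComplex.mk (Q.complex.d 1 0) (Q.augmentation ≫ E.f) (by
                rw [← Category.assoc, Q.d_comp_augmentation, zero_comp]) :=
            { τ₁ := 𝟙 _
              τ₂ := 𝟙 _
              τ₃ := E.f }
          have : Epi α.τ₁ := inferInstanceAs (Epi (𝟙 _))
          have : IsIso α.τ₂ := inferInstanceAs (IsIso (𝟙 _))
          have : Mono α.τ₃ := hE.mono_f
          exact (ShortComplex.exact_iff_of_epi_of_isIso_of_mono α).1 Q.exact_augmentation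
        | succ n => exact Q.exact_succ n
      · apply ChainComplex.exactAt_succ_single_obj⟩

variable [HasProjectiveResolutions C] (G : C ⥤ D) [G.Additive]

lemma isZero_leftDerived_iff {X : C} (P : ProjectiveResolution X) (n : ℕ) :
    IsZero ((G.leftDerived (n + 1)).obj X) ↔
      (((G.mapHomologicalComplex _).obj P.complex).sc' (n + 2) (n + 1) n).Exact := by
  rw [(P.isoLeftDerivedObj G (n + 1)).isZero_iff]
  rw [← HomologicalComplex.exactAt_iff' _ _ _ _ (by simp) (by simp)]
  exact (HomologicalComplex.exactAt_iff_isZero_homology _ _).symm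

end CategoryTheory.ProjectiveResolution

namespace CategoryTheory.Functor
variable {C D : Type*} [Category C] [Category D] [Abelian C] [Abelian D]
variable [HasProjectiveResolutions C] (G : C ⥤ D) [G.Additive]

lemma isZero_leftDerived_of_shortExact {E : ShortComplex C} (hE : E.ShortExact) [Projective E.X₂]
    (n : ℕ) (h : IsZero ((G.leftDerived (n + 2)).obj E.X₃)) :
    IsZero ((G.leftDerived (n + 1)).obj E.X₁) := by
  let Q := projectiveResolution E.X₁
  rw [Q.isZero_leftDerived_iff G]
  rw [(Q.splice hE).isZero_leftDerived_iff G (n + 1)] at h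
  exact h

lemma mono_map_of_isZero_leftDerived_one [PreservesFiniteColimits G] {E : ShortComplex C}
    (hE : E.ShortExact) [Projective E.X₂]
    (h : IsZero ((G.leftDerived 1).obj E.X₃)) : Mono (G.map E.f) := by
  let Q := projectiveResolution E.X₁
  rw [(Q.splice hE).isZero_leftDerived_iff G 0] at h
  have h : (ShortComplex.mk (G.map (Q.complex.d 1 0)) (G.map (Q.augmentation ≫ E.f)) (by
      rw [← G.map_comp, ← Category.assoc, Q.d_comp_augmentation, zero_comp, G.map_zero])).Exact := h
  have hepi : Epi (G.map Q.augmentation) := inferInstance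
  rw [Preadditive.mono_iff_cancel_zero]
  intro A x hx
  obtain ⟨A', π', _, y, hy⟩ := surjective_up_to_refinements_of_epi (G.map Q.augmentation) x
  obtain ⟨A'', π'', _, z, hz⟩ := h.exact_up_to_refinements y (by
    refine (congrArg (y ≫ ·) (G.map_comp _ _)).trans ?_
    rw [← Category.assoc, ← hy, Category.assoc, hx, comp_zero])
  dsimp only at hz
  rw [← cancel_epi π', ← cancel_epi π'', hy, ← Category.assoc, hz, Category.assoc, ← G.map_comp,
    Q.d_comp_augmentation]
  simp
end CategoryTheory.Functor

lemma ModuleCat.shortExact_of_function_exact {R N F M : Type} [CommRing R] [AddCommGroup N]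
    [Module R N] [AddCommGroup F] [Module R F] [AddCommGroup M] [Module R M] {f : N →ₗ[R] F}
    {g : F →ₗ[R] M} (hf : Function.Injective f) (hg : Function.Surjective g)
    (hfg : Function.Exact f g) :
    (ShortComplex.mk (ModuleCat.ofHom f) (ModuleCat.ofHom g)
      (ModuleCat.hom_ext (DFunLike.ext _ _ hfg.apply_apply_eq_zero))).ShortExact where
  exact := (ShortComplex.ShortExact.moduleCat_exact_iff_function_exact _).2 hfg
  mono_f := (ModuleCat.mono_iff_injective _).2 hf
  epi_g := (ModuleCat.epi_iff_surjective _).2 hg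

/-- `Tor` dimension shifting for modules. -/
lemma isZero_tor_succ_of_exact {R : Type} [CommRing R] (S : ModuleCat.{0} R) {N F M : Type}
    [AddCommGroup N] [AddCommGroup F] [AddCommGroup M] [Module R N] [Module R F] [Module R M]
    [Module.Projective R F] (f : N →ₗ[R] F) (g : F →ₗ[R] M) (hf : Function.Injective f)
    (hg : Function.Surjective g) (hfg : Function.Exact f g) (n : ℕ)
    (h : Limits.IsZero (((Tor (ModuleCat.{0} R) (n + 2)).obj S).obj (ModuleCat.of R M))) :
    Limits.IsZero (((Tor (ModuleCat.{0} R) (n + 1)).obj S).obj (ModuleCat.of R N)) := by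
  let E : ShortComplex (ModuleCat.{0} R) :=
    .mk (ModuleCat.ofHom f) (ModuleCat.ofHom g)
      (ModuleCat.hom_ext (DFunLike.ext _ _ hfg.apply_apply_eq_zero))
  have hE : E.ShortExact := ModuleCat.shortExact_of_function_exact hf hg hfg
  have : Projective E.X₂ := inferInstanceAs (Projective (ModuleCat.of R F))
  exact Functor.isZero_leftDerived_of_shortExact _ hE n h

/-- Vanishing of `Tor₁` gives injectivity after tensoring. -/
lemma lTensor_injective_of_isZero_tor_one {R : Type} [CommRing R] (S : Type) [AddCommGroup S]
    [Module R S] {N F M : Type}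
    [AddCommGroup N] [AddCommGroup F] [AddCommGroup M] [Module R N] [Module R F] [Module R M]
    [Module.Projective R F] (f : N →ₗ[R] F) (g : F →ₗ[R] M) (hf : Function.Injective f)
    (hg : Function.Surjective g) (hfg : Function.Exact f g)
    (h : Limits.IsZero (((Tor (ModuleCat.{0} R) 1).obj (ModuleCat.of R S)).obj
      (ModuleCat.of R M))) :
    Function.Injective (f.lTensor S) := by
  let E : ShortComplex (ModuleCat.{0} R) :=
    .mk (ModuleCat.ofHom f) (ModuleCat.ofHom g)
      (ModuleCat.hom_ext (DFunLike.ext _ _ hfg.apply_apply_eq_zero))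
  have hE : E.ShortExact := ModuleCat.shortExact_of_function_exact hf hg hfg
  have : Projective E.X₂ := inferInstanceAs (Projective (ModuleCat.of R F))
  exact (ModuleCat.mono_iff_injective _).1
    (Functor.mono_map_of_isZero_leftDerived_one
      ((MonoidalCategory.tensoringLeft _).obj (ModuleCat.of R S)) hE h)

end Tor

section

open Module TensorProduct

lemma Ideal.algebraMap_ne_zero_of_notMem {R K : Type*} [CommRing R] [Field K] [Algebra R K]
    [IsFractionRing R K] {p : Ideal R} {s : R} (hs : s ∉ p) : algebraMap R K s ≠ 0 := by
  rw [Ne, FaithfulSMul.algebraMap_eq_zero_iff]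
  rintro rfl
  exact hs p.zero_mem

section LocAt

variable {R : Type*} [CommRing R] [IsDomain R] (K : Type*) [Field K] [Algebra R K]
  [IsFractionRing R K] (p : Ideal R) [p.IsPrime]

/-- The localization of a domain at a prime ideal, as a subring of the fraction field. -/
noncomputable abbrev Ideal.localSubalgebra : Subalgebra R K :=
  Localization.subalgebra.ofField K p.primeCompl p.primeCompl_le_nonZeroDivisors

instance Ideal.isLocalizationAtPrime_localSubalgebra :
    IsLocalization.AtPrime (p.localSubalgebra K) p :=
  Localization.subalgebra.isLocalization_ofField K p.primeCompl p.primeCompl_le_nonZeroDivisors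

instance Ideal.isFractionRing_localSubalgebra : IsFractionRing (p.localSubalgebra K) K :=
  Localization.subalgebra.isFractionRing_ofField K p.primeCompl p.primeCompl_le_nonZeroDivisors

instance Ideal.isLocalRing_localSubalgebra : IsLocalRing (p.localSubalgebra K) :=
  IsLocalization.AtPrime.isLocalRing _ p

variable {K p}

lemma Ideal.mem_localSubalgebra {x : K} :
    x ∈ p.localSubalgebra K ↔ ∃ s ∉ p, ∃ a, algebraMap R K s * x = algebraMap R K a := by
  have key : x ∈ p.localSubalgebra K ↔ ∃ (a s : R) (_ : s ∈ p.primeCompl),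
      x = algebraMap R K a * (algebraMap R K s)⁻¹ := Iff.rfl
  rw [key]
  constructor
  · rintro ⟨a, s, hs, rfl⟩
    exact ⟨s, hs, a, by field_simp [algebraMap_ne_zero_of_notMem hs]⟩
  · rintro ⟨s, hs, a, h⟩
    exact ⟨a, s, hs, by rw [← h]; field_simp [algebraMap_ne_zero_of_notMem hs]⟩

lemma Ideal.algebraMap_inv_mem_localSubalgebra {s : R} (hs : s ∉ p) :
    (algebraMap R K s)⁻¹ ∈ p.localSubalgebra K :=
  ⟨1, s, hs, by simp⟩

lemma Ideal.localSubalgebra_anti {q : Ideal R} [q.IsPrime] (h : q ≤ p) :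
    p.localSubalgebra K ≤ q.localSubalgebra K := by
  rintro _ ⟨a, s, hs, rfl⟩
  exact ⟨a, s, fun hq ↦ hs (h hq), rfl⟩

lemma IsLocalRing.isPrincipal_maximalIdeal_of_smul_mem {A K : Type*} [CommRing A] [IsDomain A]
    [IsLocalRing A] [IsNoetherianRing A] [IsIntegrallyClosed A] [Field K] [Algebra A K]
    [IsFractionRing A K] {y : K} (hy : y ∉ (algebraMap A K).range)
    (h : ∀ m ∈ maximalIdeal A, y * algebraMap A K m ∈ (algebraMap A K).range) :
    (maximalIdeal A).IsPrincipal := by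
  by_cases h0 : maximalIdeal A = ⊥
  · rw [h0]; infer_instance
  choose! z hz using h
  by_cases hu : ∃ m ∈ maximalIdeal A, IsUnit (z m)
  · obtain ⟨m, hm, hu⟩ := hu
    refine ⟨m, le_antisymm (fun m' hm' ↦ ?_) ?_⟩
    · obtain ⟨u, hu⟩ := hu
      refine Ideal.mem_span_singleton.2 ⟨z m' * (u⁻¹ : Aˣ), ?_⟩
      rw [← mul_assoc, Units.eq_mul_inv_iff_mul_eq, hu]
      apply IsFractionRing.injective A K
      rw [map_mul, map_mul, hz m hm, hz m' hm']
      ring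
    · simpa [Ideal.span_singleton_le_iff_mem] using hm
  · push Not at hu
    refine absurd ?_ hy
    obtain ⟨d, hd, hd0⟩ := Submodule.exists_mem_ne_zero_of_ne_bot h0
    have : IsIntegral A y := by
      refine isIntegral_of_smul_mem_submodule (M := K)
        (Submodule.map (Algebra.linearMap A K) (maximalIdeal A)) ?_ ?_ y ?_
      · intro hbot
        have := (Submodule.mem_bot A).1
          (hbot ▸ Submodule.mem_map_of_mem (f := Algebra.linearMap A K) hd)
        exact hd0 (by simpa using this)
      · exact (IsNoetherian.noetherian (maximalIdeal A)).map _
      · rintro _ ⟨m, hm, rfl⟩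
        exact ⟨z m, (mem_maximalIdeal _).2 (hu m hm), by simpa using hz m hm⟩
    exact IsIntegrallyClosed.isIntegral_iff.1 this

lemma Ideal.mem_localSubalgebra_of_forall_valuationRing [IsNoetherianRing R]
    [IsIntegrallyClosed R] {x : K}
    (h : ∀ (q : Ideal R) [q.IsPrime], q ≤ p →
      (∀ y : K, y ∈ q.localSubalgebra K ∨ y⁻¹ ∈ q.localSubalgebra K) →
        x ∈ q.localSubalgebra K) :
    x ∈ p.localSubalgebra K := by
  by_contra hx
  obtain ⟨c, d, hd, rfl⟩ := IsFractionRing.div_surjective (A := R) x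
  have hd0 : algebraMap R K d ≠ 0 := by
    simpa using nonZeroDivisors.ne_zero hd
  let I : Ideal R := (Ideal.span {d}).colon {c}
  have hI (r : R) : r ∈ I ↔ d ∣ r * c := by
    simp [I, Submodule.mem_colon_singleton, Ideal.mem_span_singleton]
  have hIp : I ≤ p := by
    intro r hr
    by_contra hrp
    obtain ⟨a, ha⟩ := (hI r).1 hr
    refine hx (mem_localSubalgebra.2 ⟨r, hrp, a, ?_⟩)
    have := congrArg (algebraMap R K) ha
    rw [map_mul, map_mul] at this
    rw [← mul_div_assoc, this]
    field_simp
  obtain ⟨q, hq, hqp⟩ := Ideal.exists_minimalPrimes_le hIp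
  have : q.IsPrime := hq.1.1
  -- `q` is the annihilator of a multiple of `c` modulo `d`
  obtain ⟨e, he⟩ : ∃ e, ∀ r, r ∈ q ↔ d ∣ r * e := by
    obtain ⟨e, he⟩ := Submodule.exists_eq_colon_of_mem_minimalPrimes hq
    exact ⟨e, fun r ↦ by rw [he]; simp [Submodule.mem_colon_singleton, Ideal.mem_span_singleton]⟩
  have : IsNoetherianRing (q.localSubalgebra K) :=
    IsLocalization.isNoetherianRing q.primeCompl _ inferInstance
  have : IsIntegrallyClosed (q.localSubalgebra K) :=
    isIntegrallyClosed_of_isLocalization _ q.primeCompl q.primeCompl_le_nonZeroDivisors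
  have hA (y : K) : y ∈ (algebraMap (q.localSubalgebra K) K).range ↔ y ∈ q.localSubalgebra K :=
    ⟨by rintro ⟨y, rfl⟩; exact y.2, fun h ↦ ⟨⟨y, h⟩, rfl⟩⟩
  have hprin : (IsLocalRing.maximalIdeal (q.localSubalgebra K)).IsPrincipal := by
    apply IsLocalRing.isPrincipal_maximalIdeal_of_smul_mem (K := K)
      (y := algebraMap R K e / algebraMap R K d)
    · rw [hA, mem_localSubalgebra]
      rintro ⟨s, hs, a, h⟩
      refine hs ((he s).2 ⟨a, ?_⟩)
      apply IsFractionRing.injective R K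
      rw [map_mul, map_mul, ← h]
      field_simp
    · rintro ⟨m, hm⟩ hmm
      rw [hA]
      change _ * m ∈ _
      obtain ⟨a, s, hs, rfl⟩ := id hm
      have haq : a ∈ q := by
        by_contra ha
        refine (IsLocalRing.mem_maximalIdeal _).1 hmm (isUnit_iff_exists_inv.2
          ⟨⟨_, s, a, ha, rfl⟩, Subtype.ext ?_⟩)
        have ha0 : algebraMap R K a ≠ 0 := Ideal.algebraMap_ne_zero_of_notMem ha
        have hs0 : algebraMap R K s ≠ 0 := Ideal.algebraMap_ne_zero_of_notMem hs
        change algebraMap R K a * (algebraMap R K s)⁻¹ *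
          (algebraMap R K s * (algebraMap R K a)⁻¹) = 1
        field_simp
      obtain ⟨b, hb⟩ := (he a).1 haq
      refine ⟨b, s, hs, ?_⟩
      have := congrArg (algebraMap R K) hb
      rw [map_mul, map_mul] at this
      rw [← mul_assoc, div_mul_eq_mul_div, mul_comm (algebraMap R K e), this]
      field_simp
  have hval : ValuationRing (q.localSubalgebra K) :=
    ((tfae_of_isNoetherianRing_of_isLocalRing_of_isDomain _).out 4 1).1 hprin
  have hx' := h q hqp fun y ↦ by
    simpa only [← hA, IsLocalization.IsInteger, RingHom.mem_rangeS, RingHom.mem_range] using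
      ValuationRing.isInteger_or_isInteger (q.localSubalgebra K) y
  obtain ⟨s, hs, a, h⟩ := mem_localSubalgebra.1 hx'
  refine absurd (hq.1.2 ((hI s).2 ⟨a, ?_⟩)) hs
  apply IsFractionRing.injective R K
  rw [map_mul, map_mul, ← h]
  field_simp

end LocAt

lemma ValuationSubring.exists_perm_sub_sum_smul_mem {K V : Type*} [Field K] [AddCommGroup V]
    [Module K V] {ι κ : Type*} [Finite ι] [Fintype κ] (A : ValuationSubring K)
    (b : Basis (ι ⊕ κ) K V) (W : Submodule K V) (e : Basis κ K (V ⧸ W)) :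
    ∃ (π : Equiv.Perm (ι ⊕ κ)) (c : ι → κ → K), (∀ i j, c i j ∈ A) ∧
      ∀ i, b (π (.inl i)) - ∑ j, c i j • b (π (.inr j)) ∈ W := by
  classical
  let q (k : ι ⊕ κ) : V ⧸ W := W.mkQ (b k)
  obtain ⟨σ, hσ⟩ := Finite.exists_max fun σ : κ → ι ⊕ κ ↦ A.valuation (e.det (q ∘ σ))
  have hσ0 : e.det (q ∘ σ) ≠ 0 := by
    intro h0
    have hz (τ : κ → ι ⊕ κ) : e.det (q ∘ τ) = 0 := by
      simpa [h0] using hσ τ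
    have hmul : (e.det.compLinearMap W.mkQ).toMultilinearMap = 0 :=
      Basis.ext_multilinear (fun _ ↦ b) fun τ ↦ hz τ
    choose v hv using fun j ↦ W.mkQ_surjective (e j)
    have := congrArg (fun f ↦ f v) hmul
    have h1 : e.det (fun j ↦ W.mkQ (v j)) = 0 := this
    rw [funext hv, e.det_self] at h1
    exact one_ne_zero h1
  have hinj : Function.Injective σ := by
    by_contra h
    exact hσ0 (e.det.map_eq_zero_of_not_injective _ fun h' ↦ h (Function.Injective.of_comp h'))
  obtain ⟨hli, hsp⟩ := (Module.Basis.is_basis_iff_det e).2 hσ0.isUnit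
  let g : Basis κ K (V ⧸ W) := Basis.mk hli hsp.ge
  have hg (j : κ) : g j = q (σ j) := by simp [g]
  let E : {x : ι ⊕ κ // x ∈ Set.range Sum.inr} ≃ {x : ι ⊕ κ // x ∈ Set.range σ} :=
    (Equiv.ofInjective _ Sum.inr_injective).symm.trans (Equiv.ofInjective σ hinj)
  have hE (j : κ) : E.extendSubtype (.inr j) = σ j := by
    rw [Equiv.extendSubtype_apply_of_mem _ _ ⟨j, rfl⟩]
    have := Equiv.ofInjective_symm_apply (f := (Sum.inr : κ → ι ⊕ κ)) Sum.inr_injective j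
    simp only [E, Equiv.trans_apply, this, Equiv.ofInjective_apply]
  refine ⟨E.extendSubtype, fun i j ↦ g.repr (q (E.extendSubtype (.inl i))) j, fun i j ↦ ?_,
    fun i ↦ ?_⟩
  · have h := Basis.det_smul_mk_coord_eq_det_update e hli hsp.ge j
    have h2 := congrArg (fun f ↦ f (q (E.extendSubtype (.inl i)))) h
    rw [← A.valuation_le_one_iff]
    have h3 : e.det (q ∘ σ) * g.repr (q (E.extendSubtype (.inl i))) j =
      e.det (q ∘ (Function.update σ j (E.extendSubtype (.inl i)))) := by
      rw [Function.comp_update]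
      exact h2
    have h4 := hσ (Function.update σ j (E.extendSubtype (.inl i)))
    rw [← h3, map_mul] at h4
    exact le_of_mul_le_mul_left (by simpa using h4) (by simpa [zero_lt_iff] using hσ0)
  · rw [← Submodule.Quotient.mk_eq_zero, ← Submodule.mkQ_apply, map_sub, map_sum, sub_eq_zero]
    change q _ = _
    conv_lhs => rw [← g.sum_repr (q _)]
    refine Finset.sum_congr rfl fun j _ ↦ ?_
    rw [map_smul, hE, hg]

section

variable {K V ι κ : Type*} [Field K] [AddCommGroup V] [Module K V] [Fintype ι] [Fintype κ]
  [DecidableEq ι] [DecidableEq κ]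

lemma Module.Basis.det_sumElim_of_eq_smul_sub_sum (b : Basis (ι ⊕ κ) K V) (s : K)
    (c : ι → κ → K) :
    b.det (Sum.elim (fun i ↦ s • b (.inl i) - ∑ j, c i j • b (.inr j)) fun j ↦ b (.inr j)) =
      s ^ Fintype.card ι := by
  have : b.toMatrix (Sum.elim (fun i ↦ s • b (.inl i) - ∑ j, c i j • b (.inr j))
      fun j ↦ b (.inr j)) = Matrix.fromBlocks (s • 1) 0 (-(Matrix.of c).transpose) 1 := by
    ext i j
    rcases i with i | i <;> rcases j with j | j <;>
      simp [Basis.toMatrix_apply, Finsupp.single_apply, Matrix.one_apply, eq_comm]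
  rw [Basis.det_apply, this, Matrix.det_fromBlocks_zero₁₂]
  simp

lemma Module.Basis.det_sumQuot_sumElim (W : Submodule K V) (eW : Basis ι K W)
    (eQ : Basis κ K (V ⧸ W)) (n : ι → W) (f : κ → V) :
    (eW.sumQuot eQ).det (Sum.elim (fun i ↦ (n i : V)) f) =
      eW.det n * eQ.det fun j ↦ W.mkQ (f j) := by
  have : (eW.sumQuot eQ).toMatrix (Sum.elim (fun i ↦ (n i : V)) f) = Matrix.fromBlocks
      (eW.toMatrix n) (Matrix.of fun i j ↦ (eW.sumQuot eQ).repr (f j) (.inl i)) 0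
      (eQ.toMatrix fun j ↦ W.mkQ (f j)) := by
    ext i j
    rcases i with i | i <;> rcases j with j | j
    · simp only [Basis.toMatrix_apply, Matrix.fromBlocks_apply₁₁, Sum.elim_inl]
      exact Basis.sumQuot_repr_inl_of_mem ..
    · simp [Basis.toMatrix_apply]
    · simp [Basis.toMatrix_apply, (Submodule.Quotient.mk_eq_zero W).2 (n j).2]
    · simp [Basis.toMatrix_apply]
  rw [Basis.det_apply, this, Matrix.det_fromBlocks_zero₂₁, Basis.det_apply, Basis.det_apply]

lemma Module.Basis.det_eq_det_mul_det (b e : Basis ι K V) (v : ι → V) :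
    b.det v = b.det e * e.det v := by
  conv_lhs => rw [b.det.eq_smul_basis_det e]
  simp

end

section

variable {R : Type*} [CommRing R] [IsDomain R] {K : Type*} [Field K] [Algebra R K]
  [IsFractionRing R K] {p : Ideal R} [p.IsPrime]

lemma Ideal.exists_forall_algebraMap_mul_eq {α : Type*} [Finite α] {x : α → K}
    (hx : ∀ i, x i ∈ p.localSubalgebra K) :
    ∃ s ∉ p, ∃ a : α → R, ∀ i, algebraMap R K s * x i = algebraMap R K (a i) := by
  classical
  cases nonempty_fintype α
  choose s hs a ha using fun i ↦ mem_localSubalgebra.1 (hx i)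
  refine ⟨∏ i, s i, fun h ↦ ?_, fun i ↦ (∏ j ∈ Finset.univ.erase i, s j) * a i, fun i ↦ ?_⟩
  · obtain ⟨i, -, hi⟩ := Ideal.IsPrime.prod_mem_iff.1 h
    exact hs i hi
  · rw [← Finset.mul_prod_erase _ _ (Finset.mem_univ i), map_mul, map_mul, ← ha]
    ring

variable {V : Type*} [AddCommGroup V] [Module K V] [Module R V] [IsScalarTower R K V]

variable (p) in
/-- Let `L` be an `R`-lattice in a finite-dimensional `K`-vector space. This says that the elements
`c : K` such that `c` times every determinant of vectors of `L` lies in the localization of `R` at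
`p` form a principal fractional ideal of this localization. -/
def Ideal.IsDetPrincipal (K : Type*) [Field K] [Algebra R K]
    [IsFractionRing R K] {V : Type*} [AddCommGroup V] [Module K V] [Module R V]
    (L : Submodule R V) : Prop :=
  ∃ (ι : Type) (_ : Fintype ι) (_ : DecidableEq ι) (e : Basis ι K V) (w : K), w ≠ 0 ∧
    ∀ c : K, (∀ v : ι → V, (∀ i, v i ∈ L) → c * e.det v ∈ p.localSubalgebra K) ↔
      ∃ a ∈ p.localSubalgebra K, c = a * w

lemma Ideal.IsDetPrincipal.map {L : Submodule R V} (h : p.IsDetPrincipal K L)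
    {V' : Type*} [AddCommGroup V'] [Module K V'] [Module R V'] [IsScalarTower R K V']
    (φ : V ≃ₗ[K] V') : p.IsDetPrincipal K (L.map (φ.toLinearMap.restrictScalars R)) := by
  obtain ⟨ι, _, _, e, w, hw, H⟩ := h
  refine ⟨ι, inferInstance, inferInstance, e.map φ, w, hw, fun c ↦ ?_⟩
  rw [← H]
  simp only [Basis.det_map]
  constructor
  · intro h v hv
    simpa [Function.comp_def] using h (fun i ↦ φ (v i)) fun i ↦ ⟨v i, hv i, rfl⟩
  · intro h v hv
    refine h _ fun i ↦ ?_
    obtain ⟨y, hy, hyv⟩ := hv i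
    simpa [← hyv] using hy

lemma Module.Basis.det_mem_range_algebraMap {ι : Type*} [Fintype ι] [DecidableEq ι]
    (b : Basis ι K V) {v : ι → V} (hv : ∀ i, v i ∈ Submodule.span R (Set.range b)) :
    ∃ a, b.det v = algebraMap R K a := by
  choose A hA using fun i j ↦ (b.mem_span_iff_repr_mem R (v i)).1 (hv i) j
  refine ⟨(Matrix.of A).transpose.det, ?_⟩
  rw [Basis.det_apply, RingHom.map_det]
  congr 1
  ext i j
  simp [Basis.toMatrix_apply, hA]

lemma Module.Basis.exists_det_sumElim_eq_smul {ι κ : Type*} [Fintype ι] [Fintype κ]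
    [DecidableEq ι] [DecidableEq κ] (q : Ideal R) [q.IsPrime]
    (hq : ∀ y : K, y ∈ q.localSubalgebra K ∨ y⁻¹ ∈ q.localSubalgebra K)
    (b : Basis (ι ⊕ κ) K V) (W : Submodule K V) (e : Basis κ K (V ⧸ W)) :
    ∃ (n : ι → W) (f : κ → V), (∀ i, (n i : V) ∈ Submodule.span R (Set.range b)) ∧
      (∀ j, f j ∈ Submodule.span R (Set.range b)) ∧
      ∃ t ∉ q, b.det (Sum.elim (fun i ↦ (n i : V)) f) = algebraMap R K t := by
  let A : ValuationSubring K :=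
    { (q.localSubalgebra K).toSubring with mem_or_inv_mem' := hq }
  obtain ⟨π, c, hc, hW⟩ := A.exists_perm_sub_sum_smul_mem b W e
  obtain ⟨s, hs, a, ha⟩ := Ideal.exists_forall_algebraMap_mul_eq (p := q)
    (x := fun ij : ι × κ ↦ c ij.1 ij.2) fun ij ↦ hc _ _
  let b' := b.reindex π.symm
  have hb' (i) : b' i = b (π i) := by simp [b']
  have hmem (i) : b (π i) ∈ Submodule.span R (Set.range b) := Submodule.subset_span ⟨_, rfl⟩
  refine ⟨fun i ↦ algebraMap R K s • ⟨_, hW i⟩, fun j ↦ b (π (.inr j)), fun i ↦ ?_,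
    fun j ↦ hmem _, ((π.sign : ℤ) : R) * s ^ Fintype.card ι, fun h ↦ ?_, ?_⟩
  · rw [Submodule.coe_smul, algebraMap_smul, smul_sub, Finset.smul_sum]
    refine sub_mem (Submodule.smul_mem _ _ (hmem _)) (sum_mem fun j _ ↦ ?_)
    rw [← algebraMap_smul K s, smul_smul, ha (i, j), algebraMap_smul]
    exact Submodule.smul_mem _ _ (hmem _)
  · obtain h | h := Ideal.IsPrime.mem_or_mem ‹_› h
    · refine Ideal.IsPrime.ne_top ‹_› (Ideal.eq_top_of_isUnit_mem q h ?_)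
      exact (π.sign.isUnit.map (Int.castRingHom R))
    · exact hs (Ideal.IsPrime.mem_of_pow_mem ‹_› _ h)
  · have h1 := b'.det_sumElim_of_eq_smul_sub_sum (algebraMap R K s)
      fun i j ↦ algebraMap R K s * c i j
    have h2 : b.det b' = ((π.sign : ℤ) : K) := by
      have : (b' : ι ⊕ κ → V) = b ∘ π := funext hb'
      rw [this, AlternatingMap.map_perm, b.det_self]
      simp [Units.smul_def]
    rw [b.det_eq_det_mul_det b', h2]
    simp only [hb'] at h1
    simp only [Submodule.coe_smul, smul_sub, Finset.smul_sum, smul_smul, h1]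
    simp

lemma Ideal.IsDetPrincipal.map_mkQ [IsNoetherianRing R] [IsIntegrallyClosed R]
    {τ : Type*} [Finite τ] (b : Basis τ K V) (W : Submodule K V)
    (h : p.IsDetPrincipal K
      ((Submodule.span R (Set.range b)).comap (W.subtype.restrictScalars R))) :
    p.IsDetPrincipal K ((Submodule.span R (Set.range b)).map (W.mkQ.restrictScalars R)) := by
  classical
  have : FiniteDimensional K V := b.finiteDimensional_of_finite
  obtain ⟨ι, _, _, eW, w, hw, H⟩ := h
  set L := Submodule.span R (Set.range b) with hL
  let eQ := finBasis K (V ⧸ W)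
  let e := eW.sumQuot eQ
  obtain ⟨b', hb'⟩ : ∃ b' : Basis (ι ⊕ Fin (finrank K (V ⧸ W))) K V,
      L = Submodule.span R (Set.range b') :=
    ⟨b.reindex (b.indexEquiv e), by rw [Basis.range_reindex]⟩
  have hu : b'.det e ≠ 0 := (b'.isUnit_det e).ne_zero
  set u := b'.det e
  have hdet (n : ι → W) (f) : b'.det (Sum.elim (fun i ↦ (n i : V)) f) =
      u * (eW.det n * eQ.det fun j ↦ W.mkQ (f j)) := by
    rw [b'.det_eq_det_mul_det e, Basis.det_sumQuot_sumElim]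
  refine ⟨_, inferInstance, inferInstance, eQ, u / w, by positivity, fun c ↦ ⟨fun hc ↦ ?_, ?_⟩⟩
  · refine ⟨c * w / u, ?_, by field_simp⟩
    refine Ideal.mem_localSubalgebra_of_forall_valuationRing fun q _ hqp hq ↦ ?_
    obtain ⟨n, f, hn, hf, t, ht, hnf⟩ := b'.exists_det_sumElim_eq_smul q hq W eQ
    rw [← hb'] at hn hf
    have ht0 : algebraMap R K t ≠ 0 := Ideal.algebraMap_ne_zero_of_notMem ht
    have h1 := hc _ fun j ↦ ⟨f j, hf j, rfl⟩
    have h2 := (H w).2 ⟨1, one_mem _, by simp⟩ n hn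
    have h3 : c * w / u =
        (c * eQ.det fun j ↦ W.mkQ (f j)) * (w * eW.det n) * (algebraMap R K t)⁻¹ := by
      rw [hdet] at hnf
      field_simp
      rw [← hnf]
      ring
    rw [h3]
    exact mul_mem (Ideal.localSubalgebra_anti hqp (mul_mem h1 h2))
      (Ideal.algebraMap_inv_mem_localSubalgebra ht)
  · rintro ⟨a, ha, rfl⟩ v hv
    choose f hf hfv using hv
    obtain ⟨a', ha', h⟩ := (H (a * u * eQ.det v)).1 fun n hn ↦ by
      obtain ⟨d, hd⟩ := b'.det_mem_range_algebraMap (R := R)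
        (v := Sum.elim (fun i ↦ (n i : V)) f) (by
        rw [← hb']
        rintro (i | j)
        exacts [hn i, hf j])
      rw [hdet] at hd
      have hfv' : (fun j ↦ W.mkQ (f j)) = v := funext hfv
      rw [hfv'] at hd
      have : a * u * eQ.det v * eW.det n = a * algebraMap R K d := by rw [← hd]; ring
      rw [this]
      exact mul_mem ha (Subalgebra.algebraMap_mem _ _)
    have : a * (u / w) * eQ.det v = a' := by
      field_simp
      rw [h, mul_comm]
    rwa [this]

end

lemma LinearMap.lTensor_baseChange_injective_iff {R B C N F : Type*} [CommRing R] [CommRing B]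
    [Algebra R B] [AddCommGroup C] [Module R C] [Module B C] [IsScalarTower R B C] [AddCommGroup N]
    [AddCommGroup F] [Module R N] [Module R F] (f : N →ₗ[R] F) :
    Function.Injective ((f.baseChange B).lTensor C) ↔ Function.Injective (f.lTensor C) := by
  let eN := AlgebraTensorModule.cancelBaseChange R B B C N
  let eF := AlgebraTensorModule.cancelBaseChange R B B C F
  have h : eF ∘ ((f.baseChange B).lTensor C) = f.lTensor C ∘ eN := by
    have : eF.toLinearMap.restrictScalars R ∘ₗ ((f.baseChange B).lTensor C).restrictScalars R =
        f.lTensor C ∘ₗ eN.toLinearMap.restrictScalars R := by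
      ext x
      induction x with
      | zero => simp
      | add x y hx hy => rw [map_add, hx, hy, map_add]
      | tmul c y =>
        induction y with
        | zero => simp
        | add x y hx hy => rw [tmul_add, map_add, hx, hy, map_add]
        | tmul b n => simp [eN, eF]
    exact congrArg DFunLike.coe this
  rw [← eF.injective.of_comp_iff, h, Function.Injective.of_comp_iff' _ eN.bijective]

section

variable {R : Type*} [CommRing R] [IsDomain R] {K : Type*} [Field K] [Algebra R K]
  [IsFractionRing R K] {p : Ideal R} [p.IsPrime]

lemma Module.free_localSubalgebra_tensorProduct_of_lTensor_injective {S : Type*} [CommRing S]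
    [IsDomain S] [Algebra R S] (hp : RingHom.ker (algebraMap R S) = p) {N F M : Type*}
    [AddCommGroup N] [AddCommGroup F] [AddCommGroup M] [Module R N] [Module R F] [Module R M]
    [Module.Finite R N] [Module.Finite R F] [Module.Free R F] {f : N →ₗ[R] F} {g : F →ₗ[R] M}
    (hg : Function.Surjective g) (hfg : Function.Exact f g)
    (hf : Function.Injective (f.lTensor S)) :
    Module.Free (p.localSubalgebra K) (p.localSubalgebra K ⊗[R] M) := by
  let A := p.localSubalgebra K
  let E := FractionRing S
  have hker (r : R) : r ∈ p ↔ algebraMap R E r = 0 := by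
    rw [← hp, RingHom.mem_ker, IsScalarTower.algebraMap_apply R S E,
      FaithfulSMul.algebraMap_eq_zero_iff S E]
  let φ : A →+* E := IsLocalization.lift (M := p.primeCompl) (g := algebraMap R E)
    fun s ↦ (isUnit_iff_ne_zero.2 fun h ↦ s.2 ((hker _).2 h))
  have hφ (r : R) : φ (algebraMap R A r) = algebraMap R E r := IsLocalization.lift_eq ..
  have : IsLocalHom φ := by
    refine ⟨fun x hx ↦ ?_⟩
    obtain ⟨a, s, rfl⟩ := IsLocalization.exists_mk'_eq p.primeCompl x
    rw [IsLocalization.AtPrime.isUnit_mk'_iff A p]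
    intro ha
    refine hx.ne_zero ?_
    rw [IsLocalization.lift_mk', (hker a).1 ha, zero_mul]
  let k := IsLocalRing.ResidueField A
  let ψ : k →+* E := IsLocalRing.ResidueField.lift φ
  let : Algebra k E := ψ.toAlgebra
  have : IsScalarTower R k E := .of_algebraMap_eq fun r ↦ (hφ r).symm
  have hE : Function.Injective (f.lTensor E) := by
    rw [← LinearMap.lTensor_baseChange_injective_iff (B := S)]
    exact Module.Flat.lTensor_preserves_injective_linearMap _ hf
  have hk : Function.Injective (f.lTensor k) := by
    obtain ⟨ρ, hρ⟩ := (Algebra.linearMap k E).exists_leftInverse_of_injective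
      (LinearMap.ker_eq_bot.2 (algebraMap k E).injective)
    let i : k →ₗ[R] E := (Algebra.linearMap k E).restrictScalars R
    have hi : Function.Injective (i.rTensor N) := by
      refine Function.LeftInverse.injective (g := (ρ.restrictScalars R).rTensor N) fun x ↦ ?_
      rw [← LinearMap.comp_apply, ← LinearMap.rTensor_comp]
      have : ρ.restrictScalars R ∘ₗ i = LinearMap.id :=
        LinearMap.ext fun x ↦ DFunLike.congr_fun hρ x
      rw [this, LinearMap.rTensor_id, LinearMap.id_apply]
    refine Function.Injective.of_comp (f := i.rTensor F) ?_
    rw [← LinearMap.coe_comp, LinearMap.rTensor_comp_lTensor, ← LinearMap.lTensor_comp_rTensor,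
      LinearMap.coe_comp]
    exact hE.comp hi
  refine Module.free_of_lTensor_residueField_injective (f.baseChange A) (g.baseChange A)
    (LinearMap.lTensor_surjective _ hg) (lTensor_exact _ hfg hg) ?_
  rwa [LinearMap.lTensor_baseChange_injective_iff]

end

lemma Ideal.isDetPrincipal_range_of_free {R K : Type} [CommRing R] [IsDomain R] [Field K]
    [Algebra R K] [IsFractionRing R K] {p : Ideal R} [p.IsPrime] {M V : Type}
    [AddCommGroup M] [Module R M] [Module.Finite R M]
    [Module.Free (p.localSubalgebra K) (p.localSubalgebra K ⊗[R] M)]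
    [AddCommGroup V] [Module K V] [Module R V] [IsScalarTower R K V] {j : M →ₗ[R] V}
    (hj : Function.Injective j) (hspan : Submodule.span K (Set.range j) = ⊤) :
    p.IsDetPrincipal K (LinearMap.range j) := by
  classical
  let A := p.localSubalgebra K
  have : IsScalarTower R A V := ⟨fun r a v ↦ by
    change ((r • a : A) : K) • v = r • ((a : K) • v)
    rw [← smul_assoc]; rfl⟩
  have : IsScalarTower A K V := ⟨fun a b v ↦ by
    rw [Algebra.smul_def, mul_smul]; rfl⟩
  let J : A ⊗[R] M →ₗ[A] V := j.liftBaseChange A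
  have hs (x : A ⊗[R] M) : ∃ s ∉ p, ∃ m : M, s • x = 1 ⊗ₜ m := by
    obtain ⟨⟨m, s⟩, h⟩ := IsLocalizedModule.surj p.primeCompl (TensorProduct.mk R A M 1) x
    exact ⟨s, s.2, m, h⟩
  have hJ1 (m : M) : J (1 ⊗ₜ m) = j m := by simp [J]
  have hunit {s : R} (hs : s ∉ p) : IsUnit (algebraMap R A s) :=
    IsLocalization.map_units A (⟨s, hs⟩ : p.primeCompl)
  have hJ : Function.Injective J := by
    rw [← LinearMap.ker_eq_bot, LinearMap.ker_eq_bot']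
    intro x hx
    obtain ⟨s, hsp, m, hm⟩ := hs x
    have : j m = 0 := by
      rw [← hJ1, ← hm, ← algebraMap_smul A s x, map_smul, hx, smul_zero]
    rw [(map_eq_zero_iff j hj).1 this, tmul_zero, ← algebraMap_smul A s x] at hm
    exact (hunit hsp).smul_eq_zero.1 hm
  let c := Module.Free.chooseBasis A (A ⊗[R] M)
  have hli : LinearIndependent K (J ∘ c) :=
    (LinearIndependent.iff_fractionRing A K).1
      (c.linearIndependent.map' J (LinearMap.ker_eq_bot.2 hJ))
  have hrange (x) : J x ∈ Submodule.span A (Set.range (J ∘ c)) := by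
    rw [Set.range_comp, ← Submodule.map_span, c.span_eq]
    exact ⟨x, trivial, rfl⟩
  have hsp : Submodule.span K (Set.range (J ∘ c)) = ⊤ := by
    rw [eq_top_iff, ← hspan, Submodule.span_le]
    rintro _ ⟨m, rfl⟩
    rw [← hJ1]
    exact Submodule.span_subset_span A K _ (hrange _)
  let e : Basis _ K V := Basis.mk hli hsp.ge
  have he (i) : e i = J (c i) := by simp [e]
  refine ⟨_, inferInstance, inferInstance, e, 1, one_ne_zero, fun d ↦ ⟨fun h ↦ ?_, ?_⟩⟩
  · choose s hs m hm using fun i ↦ hs (c i)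
    have hv : (fun i ↦ j (m i)) = fun i ↦ algebraMap R K (s i) • e i := by
      ext i
      rw [he, algebraMap_smul, ← hJ1, ← hm, ← algebraMap_smul A, map_smul, algebraMap_smul]
    have h1 := h (fun i ↦ j (m i)) fun i ↦ ⟨m i, rfl⟩
    rw [hv, AlternatingMap.map_smul_univ, e.det_self, smul_eq_mul, mul_one, ← map_prod] at h1
    have hsp : ∏ i, s i ∉ p := fun h ↦ by
      obtain ⟨i, -, hi⟩ := Ideal.IsPrime.prod_mem_iff.1 h
      exact hs i hi
    have h0 : algebraMap R K (∏ i, s i) ≠ 0 := Ideal.algebraMap_ne_zero_of_notMem hsp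
    refine ⟨d, ?_, (mul_one d).symm⟩
    have := mul_mem h1 (Ideal.algebraMap_inv_mem_localSubalgebra hsp)
    rwa [mul_assoc, mul_inv_cancel₀ h0, mul_one] at this
  · rintro ⟨a, ha, rfl⟩ v hv
    obtain ⟨b, hb⟩ := e.det_mem_range_algebraMap (R := A) (v := v) (by
      intro i
      obtain ⟨m, hm⟩ := hv i
      rw [← hm, ← hJ1, show (e : _ → V) = J ∘ c from funext he]
      exact hrange _)
    rw [hb, mul_one]
    exact mul_mem ha b.2

/-- The determinant ideal of a lattice of finite `Tor` dimension is principal at `p`. -/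
theorem Ideal.isDetPrincipal_range_of_isZero_tor {R S K : Type} [CommRing R] [IsDomain R]
    [IsNoetherianRing R] [IsIntegrallyClosed R] [CommRing S] [IsDomain S] [Algebra R S] [Field K]
    [Algebra R K] [IsFractionRing R K] {p : Ideal R} [p.IsPrime]
    (hp : RingHom.ker (algebraMap R S) = p) (k : ℕ) {M V : Type} [AddCommGroup M] [Module R M]
    [Module.Finite R M] [AddCommGroup V] [Module K V] [Module R V] [IsScalarTower R K V]
    (hM : ∀ i > k, Limits.IsZero (((Tor (ModuleCat.{0} R) i).obj (ModuleCat.of R S)).obj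
      (ModuleCat.of R M)))
    {j : M →ₗ[R] V} (hj : Function.Injective j) (hspan : Submodule.span K (Set.range j) = ⊤) :
    p.IsDetPrincipal K (LinearMap.range j) := by
  induction k generalizing M V with
  | zero =>
    obtain ⟨n, g, hg⟩ := Module.Finite.exists_fin' R M
    have : Module.Free (p.localSubalgebra K) (p.localSubalgebra K ⊗[R] M) :=
      Module.free_localSubalgebra_tensorProduct_of_lTensor_injective hp hg g.exact_subtype_ker_map
        (lTensor_injective_of_isZero_tor_one S _ g (LinearMap.ker g).subtype_injective hg
          g.exact_subtype_ker_map (hM 1 one_pos))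
    exact Ideal.isDetPrincipal_range_of_free hj hspan
  | succ k ih =>
    obtain ⟨n, g, hg⟩ := Module.Finite.exists_fin' R M
    let b := Pi.basisFun K (Fin n)
    let i : (Fin n → R) →ₗ[R] (Fin n → K) := (Algebra.linearMap R K).compLeft (Fin n)
    have hi : Function.Injective i := fun x y h ↦
      funext fun l ↦ IsFractionRing.injective R K (congrFun h l)
    have hib (l : Fin n) : i (Pi.single l 1) = b l := by
      ext m
      simp [i, b, Pi.single_apply, apply_ite (algebraMap R K)]
    have hspan_b : Submodule.span R (Set.range b) = LinearMap.range i := by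
      rw [LinearMap.range_eq_map, ← (Pi.basisFun R (Fin n)).span_eq, Submodule.map_span,
        ← Set.range_comp]
      congr 2
      ext1 l
      simp [← hib]
    let Θ : (Fin n → K) →ₗ[K] V := b.constr K fun l ↦ j (g (Pi.single l 1))
    have hΘ (x) : Θ (i x) = j (g x) := by
      have : Θ.restrictScalars R ∘ₗ i = j ∘ₗ g := by
        refine (Pi.basisFun R (Fin n)).ext fun l ↦ ?_
        simp only [LinearMap.comp_apply, Pi.basisFun_apply, hib]
        simp [Θ, b.constr_basis]
      exact DFunLike.congr_fun this x
    have hΘs : Function.Surjective Θ := by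
      rw [← LinearMap.range_eq_top, eq_top_iff, ← hspan, Submodule.span_le]
      rintro _ ⟨m, rfl⟩
      obtain ⟨x, rfl⟩ := hg m
      exact ⟨i x, hΘ x⟩
    let W := LinearMap.ker Θ
    let j' : LinearMap.ker g →ₗ[R] W :=
      { toFun x := ⟨i x, by simp [W, hΘ]⟩
        map_add' x y := by ext; simp
        map_smul' r x := by ext; simp }
    have hj' : Function.Injective j' := fun x y h ↦
      Subtype.ext (hi (congrArg Subtype.val h))
    have hmem (x : Fin n → R) : i x ∈ W ↔ x ∈ LinearMap.ker g := by
      rw [LinearMap.mem_ker, LinearMap.mem_ker, hΘ, map_eq_zero_iff j hj]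
    have hspan' : Submodule.span K (Set.range j') = ⊤ := by
      rw [eq_top_iff]
      rintro ⟨x, hx⟩ -
      obtain ⟨s, hs⟩ := IsLocalization.exist_integer_multiples_of_finite (nonZeroDivisors R) x
      choose a ha using hs
      have hia : i a = (s : R) • x := funext ha
      have hs0 : algebraMap R K s ≠ 0 := IsFractionRing.to_map_ne_zero_of_mem_nonZeroDivisors s.2
      have haker : a ∈ LinearMap.ker g := by
        rw [← hmem, hia, ← algebraMap_smul K]
        exact W.smul_mem _ hx
      have : (⟨x, hx⟩ : W) = (algebraMap R K s)⁻¹ • j' ⟨a, haker⟩ := by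
        rw [eq_inv_smul_iff₀ hs0]
        exact Subtype.ext ((algebraMap_smul K (s : R) x).trans hia.symm)
      rw [this]
      exact Submodule.smul_mem _ _ (Submodule.subset_span ⟨_, rfl⟩)
    have hW := ih (fun l hl ↦ by
      obtain ⟨l, rfl⟩ := Nat.exists_eq_succ_of_ne_zero (Nat.ne_zero_of_lt hl)
      exact isZero_tor_succ_of_exact _ _ g (LinearMap.ker g).subtype_injective hg
        g.exact_subtype_ker_map l (hM _ (by omega))) hj' hspan'
    have hL : LinearMap.range j' =
        (Submodule.span R (Set.range b)).comap (W.subtype.restrictScalars R) := by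
      rw [hspan_b]
      ext x
      constructor
      · rintro ⟨y, rfl⟩
        exact ⟨y, rfl⟩
      · rintro ⟨y, hy⟩
        exact ⟨⟨y, (hmem y).1 (hy ▸ x.2)⟩, Subtype.ext hy⟩
    rw [hL] at hW
    convert (hW.map_mkQ b W).map (Θ.quotKerEquivOfSurjective hΘs) using 1
    rw [hspan_b]
    ext v
    constructor
    · rintro ⟨m, rfl⟩
      obtain ⟨x, rfl⟩ := hg m
      exact ⟨_, ⟨_, ⟨x, rfl⟩, rfl⟩, hΘ x⟩
    · rintro ⟨_, ⟨_, ⟨x, rfl⟩, rfl⟩, rfl⟩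
      exact ⟨g x, (hΘ x).symm⟩

lemma LinearMap.exists_algebraMap_apply_eq {R K M : Type*} [CommRing R] [Field K] [Algebra R K]
    [IsFractionRing R K] [AddCommGroup M] [Module R M] (l : M →ₗ[R] K)
    (hl : ∀ m, ∃ a, algebraMap R K a = l m) :
    ∃ f : M →ₗ[R] R, ∀ m, algebraMap R K (f m) = l m := by
  choose f hf using hl
  have hinj := IsFractionRing.injective R K
  exact ⟨{ toFun := f
           map_add' := fun x y ↦ hinj (by simp [hf])
           map_smul' := fun r x ↦ hinj (by simp [hf, Algebra.smul_def]) }, hf⟩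

lemma Module.IsReflexive.exists_dual_apply_notMem {R K M : Type} [CommRing R] [IsDomain R]
    [IsNoetherianRing R] [Field K] [Algebra R K] [IsFractionRing R K] {p : Ideal R} [p.IsPrime]
    [AddCommGroup M] [Module R M] [Module.Finite R M] [Module.IsReflexive R M]
    (hrank : finrank K (K ⊗[R] M) = 1)
    (h : p.IsDetPrincipal K (LinearMap.range (TensorProduct.mk R K M 1))) :
    ∃ (f : Dual R M) (m : M), Function.Injective f ∧ f m ∉ p := by
  obtain ⟨ι, _, _, e, w, hw, H⟩ := h
  have hcard : Fintype.card ι = 1 := by rw [← finrank_eq_card_basis e, hrank]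
  obtain ⟨i₀, hi₀⟩ := Fintype.card_eq_one_iff.1 hcard
  let _ : Unique ι := ⟨⟨i₀⟩, hi₀⟩
  let l : M →ₗ[R] K := (e.coord i₀).restrictScalars R ∘ₗ TensorProduct.mk R K M 1
  have hlift (f : M →ₗ[R] K) : ∃ c : K, ∀ m, f m = c * l m := by
    refine ⟨f.liftBaseChange K (e i₀), fun m ↦ ?_⟩
    have h1 : (1 : K) ⊗ₜ[R] m = l m • e i₀ := by
      conv_lhs => rw [← e.sum_repr (1 ⊗ₜ m)]
      rw [Fintype.sum_unique]
      rfl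
    have h2 : f m = f.liftBaseChange K (1 ⊗ₜ m) := by simp
    rw [h2, h1, map_smul, smul_eq_mul, mul_comm]
  have hl : Function.Injective l := by
    rw [← LinearMap.ker_eq_bot, LinearMap.ker_eq_bot']
    intro m hm
    refine (Module.bijective_dual_eval R M).1 (LinearMap.ext fun f ↦ ?_)
    obtain ⟨c, hc⟩ := hlift (Algebra.linearMap R K ∘ₗ f)
    apply IsFractionRing.injective R K
    simpa [hm] using hc m
  replace H (c : K) : (∀ m, c * l m ∈ p.localSubalgebra K) ↔
      ∃ a ∈ p.localSubalgebra K, c = a * w := by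
    rw [← H]
    have hdet (v : ι → K ⊗[R] M) : e.det v = e.coord i₀ (v i₀) := by
      rw [e.det_apply, Matrix.det_unique]
      rfl
    simp only [hdet]
    constructor
    · intro h v hv
      obtain ⟨m, hm⟩ := hv i₀
      rw [← hm]
      exact h m
    · exact fun h m ↦ h (fun _ ↦ 1 ⊗ₜ m) fun _ ↦ ⟨m, rfl⟩
  -- a generator of the dual, locally at `p`
  obtain ⟨s, hs, f₀, hf₀⟩ : ∃ s ∉ p, ∃ f : Dual R M, ∀ m,
      algebraMap R K (f m) = algebraMap R K s * (w * l m) := by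
    obtain ⟨n, x, hx⟩ := Module.Finite.exists_fin (R := R) (M := M)
    obtain ⟨s, hs, a, ha⟩ := Ideal.exists_forall_algebraMap_mul_eq (p := p)
      fun i ↦ (H w).2 ⟨1, one_mem _, (one_mul w).symm⟩ (x i)
    refine ⟨s, hs, (((algebraMap R K s * w) • l).exists_algebraMap_apply_eq fun m ↦ ?_).imp
      fun f hf m ↦ by simp [hf, mul_assoc]⟩
    change (algebraMap R K s * w) • l m ∈ LinearMap.range (Algebra.linearMap R K)
    have hm : m ∈ Submodule.span R (Set.range x) := hx ▸ trivial
    induction hm using Submodule.span_induction with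
    | mem _ hx =>
      obtain ⟨i, rfl⟩ := hx
      exact ⟨a i, by simp [← ha, mul_assoc]⟩
    | zero => simp
    | add x y _ _ hx hy => rw [map_add, smul_add]; exact add_mem hx hy
    | smul r x _ hx => rw [map_smul, smul_comm]; exact Submodule.smul_mem _ _ hx
  have hs0 : algebraMap R K s ≠ 0 := Ideal.algebraMap_ne_zero_of_notMem hs
  have hf₀inj : Function.Injective f₀ := by
    rw [← LinearMap.ker_eq_bot, LinearMap.ker_eq_bot']
    intro m hm
    have := hf₀ m
    rw [hm, map_zero, eq_comm] at this
    exact (map_eq_zero_iff l hl).1 (by simpa [hs0, hw] using this)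
  have hf₀loc (f : Dual R M) : ∃ x ∈ p.localSubalgebra K, ∀ m,
      algebraMap R K (f m) = x * algebraMap R K (f₀ m) := by
    obtain ⟨c, hc⟩ := hlift (Algebra.linearMap R K ∘ₗ f)
    obtain ⟨a, ha, rfl⟩ := (H c).1 fun m ↦ by
      rw [← hc]
      exact Subalgebra.algebraMap_mem _ _
    refine ⟨a * (algebraMap R K s)⁻¹, mul_mem ha (Ideal.algebraMap_inv_mem_localSubalgebra hs),
      fun m ↦ ?_⟩
    rw [hf₀]
    have := hc m
    simp only [LinearMap.comp_apply, Algebra.linearMap_apply] at this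
    rw [this]
    field_simp
  obtain ⟨m₁, hm₁⟩ : ∃ m, f₀ m ≠ 0 := by
    by_contra! h0
    have : Subsingleton M := ⟨fun x y ↦ hf₀inj (by rw [h0, h0])⟩
    rw [finrank_zero_of_subsingleton] at hrank
    exact zero_ne_one hrank
  have hm₁K : algebraMap R K (f₀ m₁) ≠ 0 := by simpa using hm₁
  obtain ⟨n, F, hF⟩ := Module.Finite.exists_fin (R := R) (M := Dual R M)
  choose x hx hxm using fun i ↦ hf₀loc (F i)
  obtain ⟨t, ht, a, ha⟩ := Ideal.exists_forall_algebraMap_mul_eq hx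
  let Ψ : Dual R M →ₗ[R] K := (algebraMap R K t * (algebraMap R K (f₀ m₁))⁻¹) •
    (Algebra.linearMap R K ∘ₗ Dual.eval R M m₁)
  obtain ⟨Φ, hΦ⟩ := Ψ.exists_algebraMap_apply_eq fun f ↦ by
    change Ψ f ∈ LinearMap.range (Algebra.linearMap R K)
    have hf : f ∈ Submodule.span R (Set.range F) := hF ▸ trivial
    induction hf using Submodule.span_induction with
    | mem _ hf =>
      obtain ⟨i, rfl⟩ := hf
      refine ⟨a i, ?_⟩
      simp only [Algebra.linearMap_apply, ← ha, Ψ, LinearMap.smul_apply, LinearMap.comp_apply,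
        Dual.eval_apply, hxm, smul_eq_mul]
      field_simp
    | zero => simp
    | add x y _ _ hx hy => rw [map_add]; exact add_mem hx hy
    | smul r x _ hx => rw [map_smul]; exact Submodule.smul_mem _ _ hx
  obtain ⟨m, hm⟩ := (Module.bijective_dual_eval R M).2 Φ
  refine ⟨f₀, m, hf₀inj, ?_⟩
  have : f₀ m = t := by
    rw [← Dual.eval_apply R M m f₀, hm]
    apply IsFractionRing.injective R K
    rw [hΦ]
    simp [Ψ, hm₁K]
  rwa [this]

lemma finrank_fractionRing_tensorProduct_eq_one_of_dual {R S M : Type*} [CommRing R] [CommRing S]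
    [IsDomain S] [Algebra R S] [AddCommGroup M] [Module R M] {f : Dual R M} {m : M}
    (hf : Function.Injective f) (hm : algebraMap R S (f m) ≠ 0) :
    finrank (FractionRing S) (FractionRing S ⊗[S] (S ⊗[R] M)) = 1 := by
  let E := FractionRing S
  let t : E := algebraMap S E (algebraMap R S (f m))
  have ht : t ≠ 0 := by
    rwa [Ne, FaithfulSMul.algebraMap_eq_zero_iff S E]
  have hfm (x : M) : f m • x = f x • m := hf (by simp [mul_comm])
  refine finrank_eq_one ((1 : E) ⊗ₜ[S] ((1 : S) ⊗ₜ[R] m)) (fun h ↦ ?_) fun v ↦ ?_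
  · let F : S ⊗[R] M →ₗ[S] S := (Algebra.linearMap R S ∘ₗ f).liftBaseChange S
    let G : E ⊗[S] (S ⊗[R] M) →ₗ[E] E := (Algebra.linearMap S E ∘ₗ F).liftBaseChange E
    have := congrArg G h
    exact hm (by simpa [G, F] using this)
  · induction v with
    | zero => exact ⟨0, zero_smul _ _⟩
    | add x y hx hy =>
      obtain ⟨a, rfl⟩ := hx
      obtain ⟨b, rfl⟩ := hy
      exact ⟨a + b, add_smul _ _ _⟩
    | tmul e y =>
      induction y with
      | zero => exact ⟨0, by simp⟩
      | add x y hx hy =>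
        obtain ⟨a, ha⟩ := hx
        obtain ⟨b, hb⟩ := hy
        exact ⟨a + b, by rw [add_smul, ha, hb, tmul_add]⟩
      | tmul s x =>
        refine ⟨t⁻¹ * (e * algebraMap S E (s * algebraMap R S (f x))), ?_⟩
        rw [mul_smul, inv_smul_eq_iff₀ ht]
        have h1 : t • (e ⊗ₜ[S] (s ⊗ₜ[R] x)) = e ⊗ₜ[S] (s ⊗ₜ[R] (f m • x)) := by
          rw [tmul_smul, ← algebraMap_smul S (f m), tmul_smul,
            ← algebraMap_smul E (algebraMap R S _)]
        have h2 : s ⊗ₜ[R] (f x • m) = (s * algebraMap R S (f x)) • ((1 : S) ⊗ₜ[R] m) := by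
          rw [smul_tmul', smul_eq_mul, mul_one, tmul_smul, smul_tmul', Algebra.smul_def, mul_comm]
        rw [h1, hfm, h2, tmul_smul, smul_tmul', smul_tmul', smul_eq_mul, mul_one, Algebra.smul_def,
          mul_comm]

lemma Module.IsReflexive.injective_mk_one (R K M : Type*) [CommRing R] [Field K] [Algebra R K]
    [IsFractionRing R K] [AddCommGroup M] [Module R M] [Module.IsReflexive R M] :
    Function.Injective (TensorProduct.mk R K M 1) := by
  rw [injective_iff_map_eq_zero]
  intro m hm
  refine (Module.bijective_dual_eval R M).1 (LinearMap.ext fun f ↦ IsFractionRing.injective R K ?_)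
  simpa using congrArg ((Algebra.linearMap R K ∘ₗ f).liftBaseChange K) hm

lemma TensorProduct.span_range_mk_one (R A M : Type*) [CommRing R] [CommRing A] [Algebra R A]
    [AddCommGroup M] [Module R M] :
    Submodule.span A (Set.range (TensorProduct.mk R A M 1)) = ⊤ := by
  refine eq_top_iff.2 fun x _ ↦ ?_
  induction x with
  | zero => exact zero_mem _
  | add x y hx hy => exact add_mem (hx trivial) (hy trivial)
  | tmul a m =>
    have : a ⊗ₜ[R] m = a • TensorProduct.mk R A M 1 m := by simp [TensorProduct.smul_tmul']
    rw [this]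
    exact Submodule.smul_mem _ _ (Submodule.subset_span ⟨m, rfl⟩)

end

/-- base change of a rank-1 reflexive module along a finite flat dimension
map of normal domains has rank 1. -/
theorem statement11
    (R S : Type) [CommRing R] [CommRing S]
    [IsDomain R] [IsNoetherianRing R] [IsIntegrallyClosed R]
    [IsDomain S] [IsNoetherianRing S] [IsIntegrallyClosed S]
    [Algebra R S] (hffd : HasFiniteFlatDimension R S)
    (M : Type) [AddCommGroup M] [Module R M] [Module.Finite R M]
    (hrefl : Module.IsReflexive R M)
    (hrank : Module.finrank (FractionRing R) (TensorProduct R (FractionRing R) M) = 1) :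
    Module.finrank (FractionRing S)
      (TensorProduct S (FractionRing S) (TensorProduct R S M)) = 1 := by
  obtain ⟨n, hn⟩ := hffd
  have : (RingHom.ker (algebraMap R S)).IsPrime := RingHom.ker_isPrime _
  have hdet := Ideal.isDetPrincipal_range_of_isZero_tor (S := S) rfl n
    (fun i hi ↦ haveI := hn (ModuleCat.of R M) i hi; ModuleCat.isZero_of_subsingleton _)
    (Module.IsReflexive.injective_mk_one R (FractionRing R) M)
    (TensorProduct.span_range_mk_one R (FractionRing R) M)
  obtain ⟨f, m, hf, hfm⟩ := Module.IsReflexive.exists_dual_apply_notMem hrank hdet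
  exact finrank_fractionRing_tensorProduct_eq_one_of_dual hf (mt RingHom.mem_ker.2 hfm)
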